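/- Assume α and β satisfy conditions (C1), (C2), (C3) and (C4) with t′ = 2t. Then for all natural numbers r₁ ≤ t and r₂ ≤ t, every natural number q with t−r₁ ≤ q ≤ t+r₁ and t−r₂ ≤ q ≤ t+r₂, every natural number a with t−r₁ ≤ a ≤ t+r₁, and every natural number b with t−r₂ ≤ b ≤ t+r₂, one has Σ_{j∈ℤ} CG(r₁,a,q,j) · CG(r₂,b,q,j) · ( α_{j+a}·α_{j+b} − β_{j+a}·β_{j+b} ) = 0 (all but finitely many terms of the sum vanish). This is the diagonal Knill–Laflamme condition ⟨c₀|(E^{r₂,δJ}_{δm₂})†E^{r₁,δJ}_{δm₁}|c₀⟩ = ⟨c₁|(E^{r₂,δJ}_{δm₂})†E^{r₁,δJ}_{δm₁}|c₁⟩ for all absorption-emission error operators of order at most t. -/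

import Mathlib

/-- Binomial coefficient for integer arguments, with the convention
`ibinom x k = 0` whenever `k < 0` or `k > x`. -/
def ibinom (x k : ℤ) : ℤ :=
  if 0 ≤ k ∧ k ≤ x then Nat.choose x.toNat k.toNat else 0

/-- The explicit (Racah) formula for the Clebsch–Gordan coefficient
`C^{n/2−t+q, j−n/2+t}_{n/2, j+a−n/2; r, t−a}`: for
`−min(a,q) ≤ j ≤ n − max(a, 2t−q)`,
`CG n t r q a j = sqrt( C(n,t+r−q)·C(2r,r+t−q) /
  (C(n+q+r−t+1,r+t−q)·C(n,j+a)·C(2r,a+r−t)·C(n̄+q,j+q)) )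
  · Σ_{k=t−r}^{q} (−1)^k · C(q−(t−r),k−(t−r)) · C(t+r−q,a−k) · C(n̄+(t−r),j+k)`,
where `n̄ = n−2t+q`, and `CG n t r q a j = 0` otherwise. -/
noncomputable def CG (n t r q a : ℕ) (j : ℤ) : ℝ :=
  if -(min (a : ℤ) (q : ℤ)) ≤ j ∧ j ≤ (n : ℤ) - max (a : ℤ) (2 * (t : ℤ) - q) then
    Real.sqrt
      (((ibinom (n : ℤ) ((t : ℤ) + r - q) * ibinom (2 * (r : ℤ)) ((r : ℤ) + t - q) : ℤ) : ℝ) /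
        ((ibinom ((n : ℤ) + q + r - t + 1) ((r : ℤ) + t - q) * ibinom (n : ℤ) (j + a) *
            ibinom (2 * (r : ℤ)) ((a : ℤ) + r - t) *
            ibinom ((n : ℤ) - 2 * t + q + q) (j + q) : ℤ) : ℝ)) *
      ∑ k ∈ Finset.Icc (t - r) q,
        (-1 : ℝ) ^ k *
          ((ibinom ((q : ℤ) - ((t : ℤ) - r)) ((k : ℤ) - ((t : ℤ) - r)) *
              ibinom ((t : ℤ) + r - q) ((a : ℤ) - k) *
              ibinom ((n : ℤ) - 2 * t + q + ((t : ℤ) - r)) (j + k) : ℤ) : ℝ)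
  else 0

open Finset Polynomial in
/-- If `D` is orthogonal to all shifts of the binomial weights of order `N - e`, then it is
orthogonal to the binomial weights of order `N` times any polynomial of degree at most `e`. -/
lemma sum_choose_mul_eval_mul_eq_zero (N e : ℕ) (he : e ≤ N) (D : ℕ → ℝ)
    (h : ∀ i ≤ e, ∑ j ∈ range (N - e + 1), ((N - e).choose j : ℝ) * D (j + i) = 0)
    (P : ℝ[X]) (hP : P.natDegree ≤ e) :
    ∑ m ∈ range (N + 1), (N.choose m : ℝ) * P.eval (m : ℝ) * D m = 0 := by
  have raise : ∀ c i, i + c ≤ e →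
      ∑ j ∈ range (N - e + c + 1), ((N - e + c).choose j : ℝ) * D (j + i) = 0 := by
    intro c
    induction c with
    | zero => intro i hi; exact h i (by omega)
    | succ c ih =>
      intro i hi
      have := sum_choose_succ_mul (fun j _ => D (j + i)) (N - e + c)
      rw [← add_assoc, this, ih i (by omega)]
      have h2 := ih (i + 1) (by omega)
      simpa only [add_assoc, add_comm 1, zero_add, add_zero] using h2
  have fall : ∀ i ≤ e,
      ∑ m ∈ range (N + 1), (N.choose m : ℝ) * (m.descFactorial i : ℝ) * D m = 0 := by
    intro i hi
    have h1 := raise (e - i) i (by omega)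
    have hN : N + 1 = i + (N - i + 1) := by omega
    rw [show N - e + (e - i) = N - i by omega] at h1
    rw [hN, sum_range_add, sum_eq_zero, zero_add]
    · have : ∀ x ∈ range (N - i + 1), (N.choose (i + x) : ℝ) * ((i + x).descFactorial i : ℝ) *
          D (i + x) = (N.descFactorial i : ℝ) * (((N - i).choose x : ℝ) * D (x + i)) := by
        intro x hx
        rw [mem_range] at hx
        have h3 := Nat.choose_mul (n := N) (k := i + x) (s := i) (by omega)
        rw [add_tsub_cancel_left] at h3
        have h4 : N.choose (i + x) * (i + x).descFactorial i
            = N.descFactorial i * (N - i).choose x := by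
          rw [Nat.descFactorial_eq_factorial_mul_choose, Nat.descFactorial_eq_factorial_mul_choose]
          linear_combination (Nat.factorial i) * h3
        have h5 : (N.choose (i + x) : ℝ) * ((i + x).descFactorial i : ℝ)
            = (N.descFactorial i : ℝ) * ((N - i).choose x : ℝ) := by exact_mod_cast h4
        rw [h5, add_comm i x, mul_assoc]
      rw [sum_congr rfl this, ← mul_sum, h1, mul_zero]
    · intro m hm
      rw [Nat.descFactorial_of_lt (mem_range.1 hm)]
      simp
  have mono : ∀ p i, i + p ≤ e →
      ∑ m ∈ range (N + 1), (N.choose m : ℝ) * ((m.descFactorial i : ℝ) * (m : ℝ) ^ p) * D m = 0 := by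
    intro p
    induction p with
    | zero => intro i hi; simpa using fall i (by omega)
    | succ p ih =>
      intro i hi
      have key : ∀ m : ℕ, (m.descFactorial i : ℝ) * (m : ℝ)
          = (m.descFactorial (i + 1) : ℝ) + i * (m.descFactorial i : ℝ) := by
        intro m
        rw [Nat.descFactorial_succ]
        rcases le_or_gt i m with him | him
        · push_cast [him]; ring
        · simp [Nat.descFactorial_of_lt him]
      have : ∀ m ∈ range (N + 1),
          (N.choose m : ℝ) * ((m.descFactorial i : ℝ) * (m : ℝ) ^ (p + 1)) * D m
          = (N.choose m : ℝ) * ((m.descFactorial (i + 1) : ℝ) * (m : ℝ) ^ p) * D m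
            + i * ((N.choose m : ℝ) * ((m.descFactorial i : ℝ) * (m : ℝ) ^ p) * D m) := by
        intro m _
        linear_combination (N.choose m : ℝ) * (m : ℝ) ^ p * D m * key m
      rw [sum_congr rfl this, sum_add_distrib, ← mul_sum, ih (i + 1) (by omega),
        ih i (by omega)]
      simp
  have expand : ∀ m ∈ range (N + 1), (N.choose m : ℝ) * P.eval (m : ℝ) * D m
      = ∑ p ∈ range (e + 1), P.coeff p * ((N.choose m : ℝ) * (m : ℝ) ^ p * D m) := by
    intro m _
    rw [eval_eq_sum_range' (Nat.lt_succ_of_le hP), mul_sum, sum_mul]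
    exact sum_congr rfl fun p _ => by ring
  rw [sum_congr rfl expand, sum_comm]
  refine sum_eq_zero fun p hp => ?_
  rw [← mul_sum]
  have := mono p 0 (by rw [mem_range] at hp; omega)
  simp only [Nat.descFactorial_zero, Nat.cast_one, one_mul] at this
  rw [this, mul_zero]

lemma ibinom_natCast (n k : ℕ) : ibinom n k = n.choose k := by
  unfold ibinom
  split_ifs with h
  · simp
  · rw [Nat.choose_eq_zero_of_lt (by omega), Nat.cast_zero]

lemma ibinom_of_neg {x k : ℤ} (h : k < 0) : ibinom x k = 0 := if_neg (by omega)

lemma ibinom_of_lt {x k : ℤ} (h : x < k) : ibinom x k = 0 := if_neg (by omega)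

lemma ibinom_nonneg (x k : ℤ) : 0 ≤ ibinom x k := by
  unfold ibinom
  split_ifs <;> positivity

lemma ibinom_sub_mul_descFactorial (K l u v : ℕ) (hl : l ≤ K) (huv : u + v ≤ K) :
    ibinom ((K : ℤ) - u - v) ((l : ℤ) - u) * K.descFactorial (u + v)
      = K.choose l * (l.descFactorial u * (K - l).descFactorial v) := by
  rcases lt_or_ge l u with h | h
  · rw [ibinom_of_neg (by omega), Nat.descFactorial_of_lt h]; simp
  rcases lt_or_ge (K - l) v with h' | h'
  · rw [ibinom_of_lt (by omega), Nat.descFactorial_of_lt h']; simp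
  obtain ⟨x, rfl⟩ := Nat.exists_eq_add_of_le h
  obtain ⟨y, hy⟩ := Nat.exists_eq_add_of_le h'
  obtain rfl : K = u + x + (v + y) := by omega
  have e1 : ((u + x + (v + y) : ℕ) : ℤ) - u - v = ((x + y : ℕ) : ℤ) := by push_cast; ring
  have e2 : ((u + x : ℕ) : ℤ) - u = (x : ℕ) := by push_cast; ring
  rw [e1, e2, ibinom_natCast, add_tsub_cancel_left]
  norm_cast
  have f0 := Nat.add_choose_mul_factorial_mul_factorial x y
  have f1 := Nat.add_choose_mul_factorial_mul_factorial (u + x) (v + y)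
  rw [← Nat.choose_symm_add] at f0 f1
  have f2 := Nat.factorial_mul_descFactorial (n := u + x + (v + y)) (k := u + v) (by omega)
  have f3 := Nat.factorial_mul_descFactorial (n := u + x) (k := u) (by omega)
  have f4 := Nat.factorial_mul_descFactorial (n := v + y) (k := v) (by omega)
  rw [show u + x + (v + y) - (u + v) = x + y by omega] at f2
  rw [add_tsub_cancel_left] at f3 f4
  have hpos : 0 < x.factorial * y.factorial := by positivity
  refine Nat.eq_of_mul_eq_mul_right hpos ?_
  calc _ = ((x + y).choose x * x.factorial * y.factorial) *
        (u + x + (v + y)).descFactorial (u + v) := by ring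
    _ = (u + x + (v + y)).choose (u + x) * (u + x).factorial * (v + y).factorial := by
        rw [f0, f2, f1]
    _ = _ := by rw [← f3, ← f4]; ring

lemma ibinom_shift_eq {n t r q k : ℕ} {j : ℤ} (hn : 2 * t ≤ n) (hr : r ≤ t) (hk : t - r ≤ k)
    (hkq : k ≤ q) (hl : 0 ≤ j + q) (hK : j + q ≤ (n : ℤ) - 2 * t + q + q) :
    (ibinom ((n : ℤ) - 2 * t + q + ((t : ℤ) - r)) (j + k) : ℝ)
      * ((n - 2 * t + 2 * q).descFactorial (q - k + (k - (t - r))) : ℝ)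
      = ((n - 2 * t + 2 * q).choose (j + q).toNat : ℝ)
        * (((j + q).toNat.descFactorial (q - k) : ℝ)
          * ((n - 2 * t + 2 * q - (j + q).toNat).descFactorial (k - (t - r)) : ℝ)) := by
  have h := ibinom_sub_mul_descFactorial (n - 2 * t + 2 * q) (j + q).toNat (q - k)
    (k - (t - r)) (by omega) (by omega)
  rw [show ((n - 2 * t + 2 * q : ℕ) : ℤ) - (q - k : ℕ) - (k - (t - r) : ℕ)
      = (n : ℤ) - 2 * t + q + ((t : ℤ) - r) by omega,
    show ((j + q).toNat : ℤ) - (q - k : ℕ) = j + k by omega] at h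
  exact_mod_cast h

open Polynomial in
/-- The product of two binomial factors of the Racah sums, divided by the common normalization,
is a binomial weight of order `n - (b - a)` times a polynomial of degree at most `2t - (b - a)`. -/
lemma exists_polynomial_ibinom_mul_div {n t r₁ r₂ q a b k k' : ℕ} (hn : 2 * t ≤ n) (hab : a ≤ b)
    (hr₁ : r₁ ≤ t) (hr₂ : r₂ ≤ t)
    (hb : b ≤ t + r₂) (hk : t - r₁ ≤ k) (hkq : k ≤ q) (hk' : t - r₂ ≤ k') (hkq' : k' ≤ q)
    (hka : k ≤ a) (hkb : b + q ≤ t + r₂ + k') :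
    ∃ P : ℝ[X], P.natDegree ≤ 2 * t - (b - a) ∧ ∀ m : ℕ, m ≤ n - (b - a) →
      (if 0 ≤ (m : ℤ) - a + q ∧ (m : ℤ) - a + q ≤ (n : ℤ) - 2 * t + q + q then
        (ibinom ((n : ℤ) - 2 * t + q + ((t : ℤ) - r₁)) ((m : ℤ) - a + k) : ℝ)
          * (ibinom ((n : ℤ) - 2 * t + q + ((t : ℤ) - r₂)) ((m : ℤ) - a + k') : ℝ)
          / (ibinom ((n : ℤ) - 2 * t + q + q) ((m : ℤ) - a + q) : ℝ)
      else 0) = ((n - (b - a)).choose m : ℝ) * P.eval (m : ℝ) := by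
  set K := n - 2 * t + 2 * q with hK
  set N := n - (b - a) with hN
  set p₁ := a - k with hp₁
  set p₂ := t + r₂ + k' - (b + q) with hp₂
  set i₁ := q - k with hi₁
  set i₂ := q - k' with hi₂
  set w₁ := k - (t - r₁) with hw₁
  set w₂ := k' - (t - r₂) with hw₂
  have hd : ∀ c d : ℝ, ∀ i, ((descPochhammer ℝ i).comp (C c * X + C d)).natDegree ≤ i := by
    intro c d i
    refine natDegree_comp_le.trans ?_
    rw [descPochhammer_natDegree]
    exact (Nat.mul_le_mul_left i natDegree_linear_le).trans_eq (mul_one i)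
  refine ⟨C ((K.descFactorial (i₁ + w₂) : ℝ) / (K.descFactorial (i₁ + w₁) *
    K.descFactorial (i₂ + w₂) * N.descFactorial (p₁ + p₂))) *
    ((descPochhammer ℝ p₁).comp (C 1 * X + C 0) *
    (descPochhammer ℝ p₂).comp (C (-1) * X + C (N : ℝ)) *
    (descPochhammer ℝ i₂).comp (C 1 * X + C ((q : ℝ) - a)) *
    (descPochhammer ℝ w₁).comp (C (-1) * X + C ((K : ℝ) - q + a))), ?_, ?_⟩
  · refine (natDegree_C_mul_le _ _).trans ?_
    refine (natDegree_mul_le_of_le (natDegree_mul_le_of_le (natDegree_mul_le_of_le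
      (hd _ _ _) (hd _ _ _)) (hd _ _ _)) (hd _ _ _)).trans ?_
    omega
  intro m hm
  have e₁ : (C 1 * X + C 0 : ℝ[X]).eval (m : ℝ) = m := by simp
  have e₂ : (C (-1 : ℝ) * X + C (N : ℝ)).eval (m : ℝ) = ((N - m : ℕ) : ℝ) := by
    push_cast [hm]; simp; ring
  simp only [eval_mul, eval_comp, e₁, e₂, descPochhammer_eval_eq_descFactorial, eval_C]
  split_ifs with hj
  · obtain ⟨hj₀, hj₁⟩ := hj
    have e₃ : (C (1 : ℝ) * X + C ((q : ℝ) - a)).eval (m : ℝ)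
        = (((m : ℤ) - a + q).toNat : ℝ) := by
      have : ((((m : ℤ) - a + q).toNat : ℤ) : ℝ) = (((m : ℤ) - a + q : ℤ) : ℝ) := by
        rw [Int.toNat_of_nonneg hj₀]
      rw [Int.cast_natCast] at this
      rw [this]; push_cast; simp; ring
    have hlK : ((m : ℤ) - a + q).toNat ≤ K := by omega
    have e₄ : (C (-1 : ℝ) * X + C ((K : ℝ) - q + a)).eval (m : ℝ)
        = ((K - ((m : ℤ) - a + q).toNat : ℕ) : ℝ) := by
      rw [Nat.cast_sub hlK, ← e₃]; simp; ring
    rw [e₃, e₄, descPochhammer_eval_eq_descFactorial, descPochhammer_eval_eq_descFactorial]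
    have h₁ := ibinom_shift_eq hn hr₁ hk hkq hj₀ hj₁
    have h₂ := ibinom_shift_eq hn hr₂ hk' hkq' hj₀ hj₁
    rw [← hK, ← hi₁, ← hw₁] at h₁
    rw [← hK, ← hi₂, ← hw₂] at h₂
    have h₃ := ibinom_sub_mul_descFactorial K ((m : ℤ) - a + q).toNat i₁ w₂ hlK (by omega)
    have h₄ := ibinom_sub_mul_descFactorial N m p₁ p₂ hm (by omega)
    rw [show (K : ℤ) - i₁ - w₂ = (N : ℤ) - p₁ - p₂ by omega,
      show (((m : ℤ) - a + q).toNat : ℤ) - i₁ = (m : ℤ) - p₁ by omega] at h₃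
    have h₅ : (ibinom ((n : ℤ) - 2 * t + q + q) ((m : ℤ) - a + q) : ℝ)
        = (K.choose ((m : ℤ) - a + q).toNat : ℝ) := by
      have := ibinom_natCast K ((m : ℤ) - a + q).toNat
      rw [show (K : ℤ) = (n : ℤ) - 2 * t + q + q by omega, Int.toNat_of_nonneg hj₀] at this
      exact_mod_cast this
    have h₃' := congrArg (Int.cast : ℤ → ℝ) h₃
    have h₄' := congrArg (Int.cast : ℤ → ℝ) h₄
    push_cast at h₃' h₄'
    have n₀ : (K.choose ((m : ℤ) - a + q).toNat : ℝ) ≠ 0 := by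
      exact_mod_cast (Nat.choose_pos hlK).ne'
    have desc_ne : ∀ M i : ℕ, i ≤ M → (M.descFactorial i : ℝ) ≠ 0 := fun M i h => by
      exact_mod_cast (Nat.descFactorial_pos.2 h).ne'
    have n₁ := desc_ne K (i₁ + w₁) (by omega)
    have n₂ := desc_ne K (i₂ + w₂) (by omega)
    have n₃ := desc_ne N (p₁ + p₂) (by omega)
    rw [h₅, eq_div_of_mul_eq n₁ h₁, eq_div_of_mul_eq n₂ h₂]
    generalize (K.choose ((m : ℤ) - a + q).toNat : ℝ) = c at *
    field_simp
    set B := (ibinom ((N : ℤ) - p₁ - p₂) ((m : ℤ) - p₁) : ℝ)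
    set l := ((m : ℤ) - a + q).toNat
    linear_combination ((l.descFactorial i₂ : ℝ) * ((K - l).descFactorial w₁ : ℝ)) *
      ((K.descFactorial (i₁ + w₂) : ℝ) * h₄' - (N.descFactorial (p₁ + p₂) : ℝ) * h₃')
  · have : m < p₁ ∨ N - m < p₂ := by omega
    rcases this with h | h <;> rw [Nat.descFactorial_of_lt h] <;> simp

/-- The part of the prefactor of `CG n t r q a j` that does not depend on `j`. -/
noncomputable def cgConst (n t r q a : ℕ) : ℝ :=
  Real.sqrt
    (((ibinom (n : ℤ) ((t : ℤ) + r - q) * ibinom (2 * (r : ℤ)) ((r : ℤ) + t - q) : ℤ) : ℝ) /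
      ((ibinom ((n : ℤ) + q + r - t + 1) ((r : ℤ) + t - q) *
        ibinom (2 * (r : ℤ)) ((a : ℤ) + r - t) : ℤ) : ℝ))

/-- The coefficients of the Racah sum. -/
noncomputable def racahCoeff (t r q a k : ℕ) : ℝ :=
  (-1 : ℝ) ^ k * (ibinom ((q : ℤ) - ((t : ℤ) - r)) ((k : ℤ) - ((t : ℤ) - r)) : ℝ) *
    (ibinom ((t : ℤ) + r - q) ((a : ℤ) - k) : ℝ)

lemma CG_eq (n t r q a : ℕ) (j : ℤ)
    (hj : -(min (a : ℤ) (q : ℤ)) ≤ j ∧ j ≤ (n : ℤ) - max (a : ℤ) (2 * (t : ℤ) - q)) :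
    CG n t r q a j = cgConst n t r q a /
      (Real.sqrt (ibinom n (j + a)) * Real.sqrt (ibinom ((n : ℤ) - 2 * t + q + q) (j + q))) *
      ∑ k ∈ Finset.Icc (t - r) q,
        racahCoeff t r q a k * ibinom ((n : ℤ) - 2 * t + q + ((t : ℤ) - r)) (j + k) := by
  have nn : ∀ x k, (0 : ℝ) ≤ ibinom x k := fun x k => by exact_mod_cast ibinom_nonneg x k
  rw [CG, if_pos hj, cgConst]
  congr 1
  · rw [← Real.sqrt_mul (nn _ _), ← Real.sqrt_div' _ (mul_nonneg (nn _ _) (nn _ _)), div_div]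
    congr 2
    push_cast
    ring
  · refine Finset.sum_congr rfl fun k _ => ?_
    rw [racahCoeff]
    push_cast
    ring

lemma CG_of_not (n t r q a : ℕ) (j : ℤ)
    (hj : ¬ (-(min (a : ℤ) (q : ℤ)) ≤ j ∧ j ≤ (n : ℤ) - max (a : ℤ) (2 * (t : ℤ) - q))) :
    CG n t r q a j = 0 := if_neg hj

lemma finsum_CG_mul_CG_eq_zero (n t : ℕ) (hn : 2 * t ≤ n) (α β : ℤ → ℝ)
    (hC4 : ∀ a b : ℕ, a ≤ 2 * t → b ≤ 2 * t →
      ∑ j ∈ Finset.range (n - 2 * t + 1),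
        ((n - 2 * t).choose j : ℝ) *
          (α ((j : ℤ) + a) * α ((j : ℤ) + b) - β ((j : ℤ) + a) * β ((j : ℤ) + b)) /
          Real.sqrt ((n.choose (j + a) : ℝ) * (n.choose (j + b) : ℝ)) = 0)
    (r₁ r₂ q a b : ℕ) (hr₁ : r₁ ≤ t) (hr₂ : r₂ ≤ t)
    (hb : b ≤ t + r₂) (hab : a ≤ b) :
    ∑ᶠ j : ℤ, CG n t r₁ q a j * CG n t r₂ q b j *
      (α (j + a) * α (j + b) - β (j + a) * β (j + b)) = 0 := by
  set N := n - (b - a) with hN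
  have nn : ∀ x k, (0 : ℝ) ≤ ibinom x k := fun x k => by exact_mod_cast ibinom_nonneg x k
  let D : ℕ → ℝ := fun m =>
    (α (m : ℤ) * α ((m : ℤ) + (b - a : ℕ)) - β (m : ℤ) * β ((m : ℤ) + (b - a : ℕ))) /
      Real.sqrt ((n.choose m : ℝ) * (n.choose (m + (b - a)) : ℝ))
  have hD : ∀ i ≤ 2 * t - (b - a), ∑ j ∈ Finset.range (N - (2 * t - (b - a)) + 1),
      ((N - (2 * t - (b - a))).choose j : ℝ) * D (j + i) = 0 := by
    intro i hi
    have h := hC4 i (i + (b - a)) (by omega) (by omega)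
    rw [show N - (2 * t - (b - a)) = n - 2 * t by omega]
    refine Eq.trans (Finset.sum_congr rfl fun j _ => ?_) h
    simp only [D]
    rw [mul_div_assoc]
    push_cast
    simp only [add_assoc]
  let φ : ℕ → ℤ := fun m => (m : ℤ) - a
  have hφ : Function.Injective φ := fun x y h => by simp only [φ] at h; omega
  rw [finsum_eq_sum_of_support_subset (s := (Finset.range (N + 1)).image φ),
    Finset.sum_image hφ.injOn]
  swap
  · intro j hj
    rw [Function.mem_support] at hj
    have h₁ : -(min (a : ℤ) (q : ℤ)) ≤ j ∧ j ≤ (n : ℤ) - max (a : ℤ) (2 * (t : ℤ) - q) := by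
      by_contra h; exact hj (by rw [CG_of_not _ _ _ _ _ _ h]; ring)
    have h₂ : -(min (b : ℤ) (q : ℤ)) ≤ j ∧ j ≤ (n : ℤ) - max (b : ℤ) (2 * (t : ℤ) - q) := by
      by_contra h; exact hj (by rw [CG_of_not _ _ _ _ _ _ h]; ring)
    simp only [Finset.coe_image, Set.mem_image, Finset.mem_coe, Finset.mem_range, φ]
    exact ⟨(j + a).toNat, by omega, by omega⟩
  let g : ℕ → ℕ → ℕ → ℝ := fun k k' m =>
    if 0 ≤ (m : ℤ) - a + q ∧ (m : ℤ) - a + q ≤ (n : ℤ) - 2 * t + q + q then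
      (ibinom ((n : ℤ) - 2 * t + q + ((t : ℤ) - r₁)) ((m : ℤ) - a + k) : ℝ)
        * (ibinom ((n : ℤ) - 2 * t + q + ((t : ℤ) - r₂)) ((m : ℤ) - a + k') : ℝ)
        / (ibinom ((n : ℤ) - 2 * t + q + q) ((m : ℤ) - a + q) : ℝ)
    else 0
  have expand : ∀ m ∈ Finset.range (N + 1),
      CG n t r₁ q a (φ m) * CG n t r₂ q b (φ m) *
        (α (φ m + a) * α (φ m + b) - β (φ m + a) * β (φ m + b))
      = ∑ k ∈ Finset.Icc (t - r₁) q, ∑ k' ∈ Finset.Icc (t - r₂) q,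
        cgConst n t r₁ q a * cgConst n t r₂ q b * racahCoeff t r₁ q a k * racahCoeff t r₂ q b k' *
          (g k k' m * D m) := by
    intro m hm
    rw [Finset.mem_range] at hm
    by_cases hj : 0 ≤ (m : ℤ) - a + q ∧ (m : ℤ) - a + q ≤ (n : ℤ) - 2 * t + q + q
    · have e₁ : φ m + a = m := by simp only [φ]; ring
      have e₂ : φ m + b = (m : ℤ) + (b - a : ℕ) := by simp only [φ]; omega
      rw [CG_eq n t r₁ q a (φ m) (by simp only [φ]; omega),
        CG_eq n t r₂ q b (φ m) (by simp only [φ]; omega), e₁, e₂]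
      simp only [g, if_pos hj, D, ibinom_natCast]
      have e₃ : (ibinom n ((m : ℤ) + (b - a : ℕ)) : ℝ) = n.choose (m + (b - a)) := by
        exact_mod_cast congrArg (Int.cast : ℤ → ℝ) (ibinom_natCast n (m + (b - a)))
      rw [e₃, Int.cast_natCast, Real.sqrt_mul (Nat.cast_nonneg _)]
      have hw := Real.mul_self_sqrt (nn ((n : ℤ) - 2 * t + q + q) (φ m + q))
      rw [mul_comm (_ / _) (Finset.sum _ _), mul_comm (_ / _) (Finset.sum _ _),
        mul_mul_mul_comm, Finset.sum_mul_sum, Finset.sum_mul, Finset.sum_mul]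
      refine Finset.sum_congr rfl fun k _ => ?_
      rw [Finset.sum_mul, Finset.sum_mul]
      refine Finset.sum_congr rfl fun k' _ => ?_
      rw [show (m : ℤ) - a = φ m from rfl]
      generalize Real.sqrt (ibinom _ (φ m + q)) = s at hw ⊢
      rw [← hw]
      simp only [div_eq_mul_inv, mul_inv]
      ring
    · have hg : ∀ k k', g k k' m = 0 := fun k k' => if_neg hj
      rw [CG_of_not n t r₁ q a (φ m) (by simp only [φ]; omega)]
      simp [hg]
  rw [Finset.sum_congr rfl expand, Finset.sum_comm]
  refine Finset.sum_eq_zero fun k hk => ?_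
  rw [Finset.sum_comm]
  refine Finset.sum_eq_zero fun k' hk' => ?_
  rw [Finset.mem_Icc] at hk hk'
  rw [← Finset.mul_sum]
  by_cases hka : k ≤ a
  swap
  · rw [racahCoeff, ibinom_of_neg (x := (t : ℤ) + r₁ - q) (k := (a : ℤ) - k) (by omega)]
    simp
  by_cases hkb : b + q ≤ t + r₂ + k'
  swap
  · have : racahCoeff t r₂ q b k' = 0 := by
      rw [racahCoeff, ibinom_of_lt (x := (t : ℤ) + r₂ - q) (k := (b : ℤ) - k') (by omega)]
      simp
    simp [this]
  obtain ⟨P, hP, hPg⟩ := exists_polynomial_ibinom_mul_div hn hab hr₁ hr₂ hb hk.1 hk.2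
    hk'.1 hk'.2 hka hkb
  have := sum_choose_mul_eval_mul_eq_zero N (2 * t - (b - a)) (by omega) D hD P hP
  rw [Finset.sum_congr rfl fun m hm => by
    rw [show g k k' m = _ from hPg m (Nat.lt_succ_iff.1 (Finset.mem_range.1 hm))], this, mul_zero]

/-- STATEMENT 6: if `α, β` vanish outside `{0,…,n}` and satisfy conditions
(C1)–(C4) with `t′ = 2t`, then for all `r₁, r₂ ≤ t`, all `q` with
`t−r₁ ≤ q ≤ t+r₁` and `t−r₂ ≤ q ≤ t+r₂`, all `a` with `t−r₁ ≤ a ≤ t+r₁` and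
all `b` with `t−r₂ ≤ b ≤ t+r₂`:
`Σ_{j∈ℤ} CG(r₁,a,q,j) · CG(r₂,b,q,j) · (α_{j+a}·α_{j+b} − β_{j+a}·β_{j+b}) = 0`
(the diagonal Knill–Laflamme conditions). -/
theorem stmt_7 (n t : ℕ) (hn : 2 * t ≤ n) (α β : ℤ → ℝ)
    (hα : ∀ j : ℤ, j < 0 ∨ (n : ℤ) < j → α j = 0)
    (hβ : ∀ j : ℤ, j < 0 ∨ (n : ℤ) < j → β j = 0)
    (hC1 : ∑ j ∈ Finset.range (n + 1), α j * β j = 0)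
    (hC2α : ∑ j ∈ Finset.range (n + 1), (α j) ^ 2 = 1)
    (hC2β : ∑ j ∈ Finset.range (n + 1), (β j) ^ 2 = 1)
    (hC3 : ∀ a b : ℕ, a ≤ 2 * t → b ≤ 2 * t →
      ∑ j ∈ Finset.range (n - 2 * t + 1),
        ((n - 2 * t).choose j : ℝ) * α ((j : ℤ) + a) * β ((j : ℤ) + b) /
          Real.sqrt ((n.choose (j + a) : ℝ) * (n.choose (j + b) : ℝ)) = 0)
    (hC4 : ∀ a b : ℕ, a ≤ 2 * t → b ≤ 2 * t →
      ∑ j ∈ Finset.range (n - 2 * t + 1),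
        ((n - 2 * t).choose j : ℝ) *
          (α ((j : ℤ) + a) * α ((j : ℤ) + b) - β ((j : ℤ) + a) * β ((j : ℤ) + b)) /
          Real.sqrt ((n.choose (j + a) : ℝ) * (n.choose (j + b) : ℝ)) = 0) :
    ∀ r₁ r₂ q a b : ℕ, r₁ ≤ t → r₂ ≤ t →
      t - r₁ ≤ q → q ≤ t + r₁ → t - r₂ ≤ q → q ≤ t + r₂ →
      t - r₁ ≤ a → a ≤ t + r₁ → t - r₂ ≤ b → b ≤ t + r₂ →
      ∑ᶠ j : ℤ, CG n t r₁ q a j * CG n t r₂ q b j *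
        (α (j + a) * α (j + b) - β (j + a) * β (j + b)) = 0 := by
  intro r₁ r₂ q a b hr₁ hr₂ _ _ _ _ _ ha _ hb
  rcases le_total a b with hab | hab
  · exact finsum_CG_mul_CG_eq_zero n t hn α β hC4 r₁ r₂ q a b hr₁ hr₂ hb hab
  · rw [← finsum_CG_mul_CG_eq_zero n t hn α β hC4 r₂ r₁ q b a hr₂ hr₁ ha hab]
    exact finsum_congr fun j => by ring
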